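/- arXiv:1110.4049 — 6 statements merged into one kernel-verified Lean document; each statement's English description precedes it below -/
import Mathlib

section
/- Let p be a prime, n ≥ 1, and fix nonnegative integers a_0,…,a_n and b_0,…,b_{n−1} with associated Hodge data (c_i, m, Γ, adaptedness) as in the context. Let A ∈ M_m(ℤ_p) be adapted to the Hodge structure, let N ≥ 2(n+1) be an integer, and let Ã ∈ M_m(ℤ_p) satisfy v_p(A_{rs} − Ã_{rs}) ≥ N for all indices r, s. Write det(1 − T·A) = Σ_{l=0}^m a_l T^l and det(1 − T·Ã) = Σ_{l=0}^m ã_l T^l. Then for every 0 ≤ l ≤ m one has v_p(a_l − ã_l) ≥ N + Γ(max(l−2, 0)). -/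
open scoped BigOperators

/-- Height at `l` of the Hodge polygon: the sum of the `l` smallest elements of the
multiset in which each `i : Fin (n+1)` occurs with multiplicity `c i`. -/
def hodgeGamma {n : ℕ} (c : Fin (n + 1) → ℕ) (l : ℕ) : ℕ :=
  (((∑ i : Fin (n + 1), Multiset.replicate (c i) (i : ℕ)).sort (· ≤ ·)).take l).sum

/-- `det (1 - T • A)`, the reverse characteristic polynomial of `A`. -/
noncomputable def revCharPoly {m : ℕ} {R : Type*} [CommRing R]
    (A : Matrix (Fin m) (Fin m) R) : Polynomial R :=
  (1 - (Polynomial.X : Polynomial R) • A.map Polynomial.C).det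

def wt {n : ℕ} : Fin (n + 1) ⊕ Fin n → ℕ
  | Sum.inl i => i
  | Sum.inr j => j + 1

theorem take_sum_le_of_sublist (L : List ℕ) : ∀ (M : List ℕ), L.Pairwise (· ≤ ·) → M.Sublist L →
    (L.take M.length).sum ≤ M.sum := by
  induction L with
  | nil => intro M _ h; simp
  | cons x L ih =>
    intro M hL hM
    cases M with
    | nil => simp
    | cons y M =>
      have hL' := List.pairwise_cons.1 hL
      have hM' : M.Sublist L := by simpa using hM.tail
      have h1 := ih M hL'.2 hM'
      have hy : y ∈ x :: L := hM.subset (by simp)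
      have hxy : x ≤ y := by
        rcases List.mem_cons.1 hy with h | h
        · exact h.ge
        · exact hL'.1 y h
      simp only [List.length_cons, List.take_succ_cons, List.sum_cons]
      omega

theorem take_sum_add_le (n : ℕ) (L : List ℕ) (hL : ∀ x ∈ L, x ≤ n) (x y : ℕ) :
    (L.take (x + y)).sum ≤ (L.take x).sum + n * y := by
  rw [List.take_add, List.sum_append]
  have h := List.sum_le_card_nsmul ((L.drop x).take y) n
    (fun z hz => hL z (List.mem_of_mem_drop (List.mem_of_mem_take hz)))
  have h2 : ((L.drop x).take y).length ≤ y := by simp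
  have h3 := Nat.mul_le_mul_right n h2
  simp only [smul_eq_mul] at h
  rw [mul_comm n y]
  omega

theorem hodgeGamma_mono {n : ℕ} (c : Fin (n + 1) → ℕ) {x y : ℕ} (h : x ≤ y) :
    hodgeGamma c x ≤ hodgeGamma c y := by
  obtain ⟨z, rfl⟩ := Nat.exists_eq_add_of_le h
  unfold hodgeGamma
  rw [List.take_add, List.sum_append]
  omega

theorem hodgeGamma_add_le {n : ℕ} (c : Fin (n + 1) → ℕ) (x y : ℕ) :
    hodgeGamma c (x + y) ≤ hodgeGamma c x + n * y := by
  unfold hodgeGamma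
  apply take_sum_add_le
  intro z hz
  rw [Multiset.mem_sort, Multiset.mem_sum] at hz
  obtain ⟨i, _, hi⟩ := hz
  have := Multiset.eq_of_mem_replicate hi
  omega

theorem map_wt {n m : ℕ} (a : Fin (n + 1) → ℕ) (b : Fin n → ℕ) (c : Fin (n + 1) → ℕ)
    (hc0 : c 0 = a 0) (hc : ∀ i : Fin n, c i.succ = a i.succ + b i)
    (lab : Fin m → Fin (n + 1) ⊕ Fin n)
    (hlabX : ∀ i : Fin (n + 1),
      (Finset.univ.filter fun r => lab r = Sum.inl i).card = a i)
    (hlabD : ∀ j : Fin n,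
      (Finset.univ.filter fun r => lab r = Sum.inr j).card = b j) :
    (Finset.univ : Finset (Fin m)).val.map (fun r => wt (lab r)) =
      ∑ i : Fin (n + 1), Multiset.replicate (c i) (i : ℕ) := by
  have h1 : (Finset.univ : Finset (Fin m)).val.map lab =
      ∑ x, Multiset.replicate (Finset.univ.filter fun r => lab r = x).card x := by
    ext x
    rw [Multiset.count_map, Multiset.count_sum']
    simp only [Multiset.count_replicate]
    rw [Finset.sum_ite_eq' Finset.univ x]
    simp only [Finset.mem_univ, if_true, Finset.card_def, Finset.filter_val]
    congr 2
    ext r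
    simp [eq_comm]
  have h2 := congrArg (Multiset.map wt) h1
  rw [Multiset.map_map] at h2
  change Multiset.map (wt ∘ lab) _ = _
  rw [h2, Fintype.sum_sum_type]
  simp only [hlabX, hlabD]
  rw [← Multiset.coe_mapAddMonoidHom, map_add, map_sum, map_sum]
  simp only [Multiset.coe_mapAddMonoidHom, Multiset.map_replicate, wt]
  rw [Fin.sum_univ_succ, Fin.sum_univ_succ (fun i => Multiset.replicate (c i) (i : ℕ)), hc0]
  simp only [hc, Multiset.replicate_add, Finset.sum_add_distrib, Fin.val_succ, add_assoc]

theorem hodgeGamma_le_sum {n m : ℕ} (c : Fin (n + 1) → ℕ) (w : Fin m → ℕ)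
    (hw : (Finset.univ : Finset (Fin m)).val.map w =
      ∑ i : Fin (n + 1), Multiset.replicate (c i) (i : ℕ)) (T : Finset (Fin m)) :
    hodgeGamma c T.card ≤ ∑ i ∈ T, w i := by
  unfold hodgeGamma
  rw [← hw]
  have hle : T.val.map w ≤ (Finset.univ : Finset (Fin m)).val.map w :=
    Multiset.map_le_map (Finset.val_le_iff.2 (Finset.subset_univ T))
  have hsub : ((T.val.map w).sort (· ≤ ·)).Sublist
      (((Finset.univ : Finset (Fin m)).val.map w).sort (· ≤ ·)) := by
    apply List.sublist_of_subperm_of_pairwise (r := (· ≤ ·)) _ (Multiset.pairwise_sort _ _) (Multiset.pairwise_sort _ _)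
    rw [← Multiset.coe_le]
    rw [Multiset.sort_eq, Multiset.sort_eq]
    exact hle
  have h := take_sum_le_of_sublist _ _ (Multiset.pairwise_sort _ _) hsub
  rw [Multiset.length_sort, Multiset.card_map] at h
  refine h.trans (le_of_eq ?_)
  rw [← Multiset.sum_coe, Multiset.sort_eq]
  rfl

theorem revCharPoly_coeff {m : ℕ} {R : Type*} [CommRing R] (A : Matrix (Fin m) (Fin m) R) (l : ℕ) :
    (revCharPoly A).coeff l = ∑ σ : Equiv.Perm (Fin m), ∑ S : Finset (Fin m),
      if S.card = l ∧ ∀ i ∉ S, σ i = i then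
        (Equiv.Perm.sign σ : ℤ) • ((-1) ^ l * ∏ i ∈ S, A (σ i) i) else 0 := by
  unfold revCharPoly
  rw [Matrix.det_apply, Polynomial.finsetSum_coeff]
  refine Finset.sum_congr rfl fun σ _ => ?_
  have h : ∀ i, (1 - (Polynomial.X : Polynomial R) • A.map Polynomial.C) (σ i) i =
      Polynomial.C (-A (σ i) i) * Polynomial.X + Polynomial.C (if σ i = i then 1 else 0) := by
    intro i
    simp only [Matrix.sub_apply, Matrix.smul_apply, Matrix.map_apply, Matrix.one_apply, smul_eq_mul]
    split_ifs <;> simp <;> ring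
  simp only [h]
  rw [Finset.prod_add, Finset.powerset_univ, Units.smul_def, Polynomial.coeff_smul,
    Polynomial.finsetSum_coeff, Finset.smul_sum]
  refine Finset.sum_congr rfl fun S _ => ?_
  rw [Finset.prod_mul_distrib, Finset.prod_const, ← map_prod, ← map_prod, Polynomial.coeff_mul_C,
    Polynomial.coeff_C_mul_X_pow, Finset.prod_neg]
  by_cases h1 : S.card = l
  · by_cases h2 : ∀ i ∉ S, σ i = i
    · rw [if_pos h1.symm, if_pos ⟨h1, h2⟩, h1, Finset.prod_congr (s₁ := Finset.univ \ S) rfl (g := fun _ => (1 : R))]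
      · simp
      · intro i hi
        rw [if_pos (h2 i (by simpa using hi))]
    · rw [if_neg (c := _ ∧ _) (fun h => h2 h.2)]
      push Not at h2
      obtain ⟨i, hi, hi'⟩ := h2
      rw [Finset.prod_eq_zero (i := i) (s := Finset.univ \ S)]
      · simp
      · simpa using hi
      · rw [if_neg hi']
  · rw [if_neg (Ne.symm h1), if_neg (c := _ ∧ _) (fun h => h1 h.1)]
    simp

theorem perm_count {m : ℕ} (σ : Equiv.Perm (Fin m)) (P : Fin m → Prop) [DecidablePred P] :
    (Finset.univ.filter fun i => P i ∧ ¬ P (σ i)).card =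
      (Finset.univ.filter fun i => P (σ i) ∧ ¬ P i).card := by
  have h0 : (Finset.univ.filter fun i => P (σ i)).card = (Finset.univ.filter P).card := by
    rw [← Finset.card_map σ.toEmbedding]
    congr 1
    ext i
    simp only [Finset.mem_map, Finset.mem_filter, Finset.mem_univ, true_and]
    constructor
    · rintro ⟨j, hj, rfl⟩; exact hj
    · intro hi; exact ⟨σ.symm i, by simpa using hi, by simp⟩
  have h1 := Finset.card_filter_add_card_filter_not (s := Finset.univ.filter P) (fun i => P (σ i))
  have h2 := Finset.card_filter_add_card_filter_not
    (s := Finset.univ.filter fun i => P (σ i)) P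
  rw [Finset.filter_filter, Finset.filter_filter] at h1 h2
  have h3 : (Finset.univ.filter fun i => P i ∧ P (σ i)) =
    (Finset.univ.filter fun i => P (σ i) ∧ P i) := by
    ext i; simp [and_comm]
  rw [h3] at h1
  omega

theorem term_dvd {R : Type*} [CommRing R] (q : R) {n m : ℕ} (c : Fin (n + 1) → ℕ)
    (w : Fin m → ℕ)
    (hw : (Finset.univ : Finset (Fin m)).val.map w =
      ∑ i : Fin (n + 1), Multiset.replicate (c i) (i : ℕ))
    (P : Fin m → Prop) [DecidablePred P]
    (A F : Matrix (Fin m) (Fin m) R)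
    (h1 : ∀ r s, ¬ (¬ P r ∧ P s) → q ^ w s ∣ A r s)
    (h3 : ∀ r s, P r → ¬ P s → A r s = 0)
    (N : ℕ) (hN : 2 * (n + 1) ≤ N) (hF : ∀ r s, q ^ N ∣ F r s)
    (σ : Equiv.Perm (Fin m)) (S U : Finset (Fin m)) (hσ : ∀ i ∉ S, σ i = i)
    (hU : U ⊆ S) (hne : U ≠ S) :
    q ^ (N + hodgeGamma c (S.card - 2)) ∣
      (∏ i ∈ U, A (σ i) i) * ∏ i ∈ S \ U, F (σ i) i := by
  by_cases hz : ∃ i ∈ U, P (σ i) ∧ ¬ P i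
  · obtain ⟨i, hi, hi1, hi2⟩ := hz
    rw [Finset.prod_eq_zero (f := fun i => A (σ i) i) hi (h3 _ _ hi1 hi2)]
    simp
  push Not at hz
  set B := U.filter fun i => P i ∧ ¬ P (σ i) with hB
  have hBU : B ⊆ U := Finset.filter_subset _ _
  have hBc : B.card ≤ (S \ U).card := by
    calc B.card ≤ (Finset.univ.filter fun i => P i ∧ ¬ P (σ i)).card :=
          Finset.card_le_card (Finset.filter_subset_filter _ (Finset.subset_univ _))
      _ = _ := perm_count σ P
      _ ≤ _ := by
        apply Finset.card_le_card
        intro i hi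
        simp only [Finset.mem_filter, Finset.mem_univ, true_and] at hi
        rw [Finset.mem_sdiff]
        refine ⟨?_, fun hiU => hi.2 (hz i hiU hi.1)⟩
        by_contra hiS
        rw [hσ i hiS] at hi
        exact hi.2 hi.1
  have hk : 1 ≤ (S \ U).card := by
    rw [Nat.one_le_iff_ne_zero, Finset.card_ne_zero, Finset.sdiff_nonempty]
    exact fun h => hne (hU.antisymm h)
  have hc1 : (S \ U).card + U.card = S.card := Finset.card_sdiff_add_card_eq_card hU
  have hc2 : (U \ B).card + B.card = U.card := Finset.card_sdiff_add_card_eq_card hBU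
  have hd1 : q ^ (∑ i ∈ U \ B, w i) ∣ ∏ i ∈ U, A (σ i) i := by
    rw [← Finset.prod_sdiff hBU, ← Finset.prod_pow_eq_pow_sum]
    apply Dvd.dvd.mul_right
    apply Finset.prod_dvd_prod_of_dvd
    intro i hi
    apply h1
    intro h
    rw [Finset.mem_sdiff] at hi
    exact hi.2 (Finset.mem_filter.2 ⟨hi.1, h.2, h.1⟩)
  have hd2 : q ^ (N * (S \ U).card) ∣ ∏ i ∈ S \ U, F (σ i) i := by
    rw [pow_mul, ← Finset.prod_const]
    exact Finset.prod_dvd_prod_of_dvd _ _ fun i _ => hF _ _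
  refine dvd_trans (pow_dvd_pow q ?_) (pow_add q _ _ ▸ mul_dvd_mul hd1 hd2)
  have hg := hodgeGamma_le_sum c w hw (U \ B)
  obtain ⟨k, hk'⟩ := Nat.exists_eq_add_of_le hk
  have hg2 := hodgeGamma_add_le c (U \ B).card (2 * k)
  have hg3 := hodgeGamma_mono c (x := S.card - 2) (y := (U \ B).card + 2 * k) (by omega)
  rw [hk']
  nlinarith [Nat.mul_le_mul_right k hN]

/-- Precision loss for the characteristic polynomial of a matrix
adapted to the Hodge structure of the pair `(X̄, D)`: if `Ã ≡ A mod p^N` with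
`N ≥ 2(n+1)`, then the `l`-th coefficients of the reverse characteristic polynomials
agree modulo `p^(N + Γ(max(l-2,0)))`. -/
theorem precision_loss_adapted (p : ℕ) [Fact p.Prime] (n : ℕ) (hn : 1 ≤ n)
    (a : Fin (n + 1) → ℕ) (b : Fin n → ℕ) (c : Fin (n + 1) → ℕ)
    (hc0 : c 0 = a 0) (hc : ∀ i : Fin n, c i.succ = a i.succ + b i)
    (m : ℕ) (hm : m = ∑ i, c i)
    -- `lab` records the partition of the index set into the blocks `X_i` and `D_j`
    (lab : Fin m → Fin (n + 1) ⊕ Fin n)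
    (hlabX : ∀ i : Fin (n + 1),
      (Finset.univ.filter fun r => lab r = Sum.inl i).card = a i)
    (hlabD : ∀ j : Fin n,
      (Finset.univ.filter fun r => lab r = Sum.inr j).card = b j)
    (A A' : Matrix (Fin m) (Fin m) ℤ_[p])
    -- `A` is adapted to the Hodge structure:
    (hA1 : ∀ r s (i : Fin (n + 1)), lab s = Sum.inl i → (p : ℤ_[p]) ^ (i : ℕ) ∣ A r s)
    (hA2 : ∀ r s (j' j : Fin n), lab r = Sum.inr j' → lab s = Sum.inr j →
      (p : ℤ_[p]) ^ ((j : ℕ) + 1) ∣ A r s)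
    (hA3 : ∀ r s (j : Fin n) (i : Fin (n + 1)), lab r = Sum.inr j → lab s = Sum.inl i →
      A r s = 0)
    (N : ℕ) (hN : 2 * (n + 1) ≤ N)
    (hAA' : ∀ r s, (p : ℤ_[p]) ^ N ∣ (A r s - A' r s)) :
    ∀ l : ℕ, l ≤ m →
      (p : ℤ_[p]) ^ (N + hodgeGamma c (l - 2)) ∣
        ((revCharPoly A).coeff l - (revCharPoly A').coeff l) := by
  intro l _
  classical
  have hw := map_wt a b c hc0 hc lab hlabX hlabD
  rw [revCharPoly_coeff, revCharPoly_coeff, ← Finset.sum_sub_distrib]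
  refine Finset.dvd_sum fun σ _ => ?_
  rw [← Finset.sum_sub_distrib]
  refine Finset.dvd_sum fun S _ => ?_
  split_ifs with hS
  swap
  · simp
  rw [← smul_sub, ← mul_sub, zsmul_eq_mul]
  apply Dvd.dvd.mul_left
  apply Dvd.dvd.mul_left
  rw [← dvd_neg, neg_sub]
  have hexp : ∏ i ∈ S, A' (σ i) i = ∏ i ∈ S, (A (σ i) i + (A' - A) (σ i) i) := by
    refine Finset.prod_congr rfl fun i _ => ?_
    simp
  rw [hexp, Finset.prod_add, ← Finset.sum_erase_add _ _ (Finset.mem_powerset_self S)]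
  simp only [Finset.sdiff_self, Finset.prod_empty, mul_one, add_sub_cancel_right]
  refine Finset.dvd_sum fun U hU => ?_
  rw [Finset.mem_erase, Finset.mem_powerset] at hU
  rw [← hS.1]
  refine term_dvd (p : ℤ_[p]) c _ hw (fun i => (lab i).isRight = true) A (A' - A) ?_ ?_ N hN ?_
    σ S U hS.2 hU.2 hU.1
  · intro r s h
    rcases hs : lab s with i | j
    · exact hA1 r s i hs
    · rcases hr : lab r with i | j'
      · simp [hs, hr] at h
      · exact hA2 r s j' j hr hs
  · intro r s hr hs
    rcases hs' : lab s with i | j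
    · rcases hr' : lab r with i | j'
      · simp [hr'] at hr
      · exact hA3 r s j' i hr' hs'
    · simp [hs'] at hs
  · intro r s
    rw [Matrix.sub_apply, ← dvd_neg, neg_sub]
    exact hAA' r s
end

section
/- Let p be a prime, n ≥ 1, and fix nonnegative integers c_0,…,c_n with m = c_0 + ⋯ + c_n. Partition {1,…,m} into blocks G_0,…,G_n with |G_i| = c_i, and for 0 ≤ l ≤ m let Γ(l) be the sum of the l smallest elements of the multiset in which each i ∈ {0,…,n} occurs with multiplicity c_i. Let A ∈ M_m(ℤ_p) be a matrix such that every entry in a column indexed by G_i is divisible by p^i, let N ≥ n be an integer, and let Ã ∈ M_m(ℤ_p) satisfy v_p(A_{rs} − Ã_{rs}) ≥ N for all r, s. Write det(1 − T·A) = Σ_{l=0}^m a_l T^l and det(1 − T·Ã) = Σ_{l=0}^m ã_l T^l. Then for every 1 ≤ l ≤ m one has v_p(a_l − ã_l) ≥ N + Γ(l−1). -/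
open scoped BigOperators

theorem aux_take_sum : ∀ (L L' : List ℕ), L.Pairwise (· ≤ ·) → L'.Sublist L →
    (L.take L'.length).sum ≤ L'.sum := by
  intro L
  induction L with
  | nil => intro L' _ h; simp
  | cons a L ih =>
    intro L' hs h
    cases L' with
    | nil => simp
    | cons b L'' =>
      have hs' := List.pairwise_cons.mp hs
      have hb : a ≤ b := by
        have : b ∈ a :: L := h.subset (by simp)
        rcases List.mem_cons.mp this with h1 | h1
        · exact h1.ge
        · exact hs'.1 b h1
      have hsub : L''.Sublist L := by simpa using h.tail
      have := ih L'' hs'.2 hsub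
      simp only [List.length_cons, List.take_succ_cons, List.sum_cons]
      omega

theorem aux_gamma {n : ℕ} (c : Fin (n + 1) → ℕ) (m : ℕ) (lab : Fin m → Fin (n + 1))
    (hlab : ∀ i : Fin (n + 1), (Finset.univ.filter fun r => lab r = i).card = c i)
    (t : Finset (Fin m)) : hodgeGamma c t.card ≤ ∑ i ∈ t, (lab i : ℕ) := by
  have hS : (∑ i : Fin (n + 1), Multiset.replicate (c i) (i : ℕ)) =
      (Finset.univ : Finset (Fin m)).val.map (fun r => (lab r : ℕ)) := by
    have h1 : (Finset.univ : Finset (Fin m)).val.map (fun r => (lab r : ℕ)) =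
        ∑ r : Fin m, ({(lab r : ℕ)} : Multiset ℕ) := by
      have h2 := Multiset.sum_map_singleton
        ((Finset.univ : Finset (Fin m)).val.map (fun r => (lab r : ℕ)))
      rw [Multiset.map_map] at h2
      exact h2.symm
    rw [h1, ← Finset.sum_fiberwise Finset.univ lab]
    refine Finset.sum_congr rfl fun i _ => ?_
    rw [Finset.sum_congr rfl (g := fun _ => ({(i : ℕ)} : Multiset ℕ))
      (by intro x hx; rw [(Finset.mem_filter.mp hx).2]), Finset.sum_const, hlab,
      Multiset.nsmul_singleton]
  have hle : t.val.map (fun r => (lab r : ℕ)) ≤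
      ∑ i : Fin (n + 1), Multiset.replicate (c i) (i : ℕ) := by
    rw [hS]
    exact Multiset.map_le_map (Finset.val_le_iff.mpr (Finset.subset_univ t))
  unfold hodgeGamma
  generalize (∑ i : Fin (n + 1), Multiset.replicate (c i) (i : ℕ)) = S at hle
  have hsort := Multiset.pairwise_sort S (· ≤ ·)
  rw [← Multiset.sort_eq S (· ≤ ·)] at hle
  generalize S.sort (· ≤ ·) = L at hle hsort
  have hq := Multiset.coe_toList (t.val.map (fun r => (lab r : ℕ)))
  rw [← hq] at hle
  obtain ⟨l, hl1, hl2⟩ := Multiset.coe_le.mp hle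
  have := aux_take_sum L l hsort hl2
  rw [hl1.length_eq, hl1.sum_eq] at this
  simpa [Multiset.length_toList, Multiset.sum_toList] using this

theorem aux_prod {R ι : Type*} [CommRing R] [DecidableEq ι] (q : R) (N : ℕ) (e : ι → ℕ)
    (he : ∀ i, e i ≤ N) (x y : ι → R) (hx : ∀ i, q ^ e i ∣ x i)
    (hxy : ∀ i, q ^ N ∣ x i - y i) (s : Finset ι) :
    ∀ K : ℕ, (∀ j ∈ s, K ≤ ∑ i ∈ s.erase j, e i) →
      q ^ (N + K) ∣ ∏ i ∈ s, x i - ∏ i ∈ s, y i := by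
  induction s using Finset.induction_on with
  | empty => intro K _; simp
  | insert a s ha ih =>
    intro K hK
    rw [Finset.prod_insert ha, Finset.prod_insert ha]
    have hsplit : x a * ∏ i ∈ s, x i - y a * ∏ i ∈ s, y i =
        (x a - y a) * ∏ i ∈ s, x i + y a * (∏ i ∈ s, x i - ∏ i ∈ s, y i) := by ring
    rw [hsplit]
    have hya : q ^ e a ∣ y a := by
      have := dvd_sub (hx a) ((pow_dvd_pow q (he a)).trans (hxy a))
      simpa using this
    refine dvd_add ?_ ?_
    · have h1 := hK a (Finset.mem_insert_self a s)
      rw [Finset.erase_insert ha] at h1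
      rw [pow_add]
      refine mul_dvd_mul (hxy a) ((pow_dvd_pow q h1).trans ?_)
      rw [← Finset.prod_pow_eq_pow_sum]
      exact Finset.prod_dvd_prod_of_dvd _ _ fun i _ => hx i
    · have h2 := ih (K - e a) (by
        intro j hj
        have h3 := hK j (Finset.mem_insert_of_mem hj)
        have hne : a ≠ j := fun h => ha (h ▸ hj)
        rw [Finset.erase_insert_of_ne hne, Finset.sum_insert
          (fun h => ha (Finset.mem_of_mem_erase h))] at h3
        omega)
      refine (pow_dvd_pow q (show N + K ≤ e a + (N + (K - e a)) by omega)).trans ?_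
      rw [pow_add]
      exact mul_dvd_mul hya h2

theorem aux_coeff {m : ℕ} {R : Type*} [CommRing R] (A : Matrix (Fin m) (Fin m) R) (l : ℕ) :
    (revCharPoly A).coeff l = (-1) ^ l * ∑ s ∈ Finset.univ.powersetCard l,
      (A.submatrix (Subtype.val : {x // x ∈ s} → Fin m) (Subtype.val : {x // x ∈ s} → Fin m)).det := by
  have h : revCharPoly A =
      Matrix.det (1 + (Polynomial.X : Polynomial R) • (-A).map Polynomial.C) := by
    simp only [revCharPoly, sub_eq_add_neg]
    congr 2
    rw [Matrix.map_neg Polynomial.C (map_neg Polynomial.C) A, smul_neg]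
  rw [h, Matrix.coeff_det_one_add_X_smul_eq_sum_minors]
  simp only [Matrix.submatrix_neg, Pi.neg_apply, Matrix.det_neg, Fintype.card_coe, Finset.mul_sum]
  exact Finset.sum_congr rfl fun s hs => by rw [(Finset.mem_powersetCard.mp hs).2]

/-- Precision loss for the characteristic polynomial of a matrix
whose columns in the block `G_i` (of size `c i`) are divisible by `p^i`: if
`A' ≡ A mod p^N` with `N ≥ n`, then for `1 ≤ l ≤ m` the `l`-th coefficients of the
reverse characteristic polynomials agree modulo `p^(N + Γ(l-1))`. -/
theorem precision_loss_filtered (p : ℕ) [Fact p.Prime] (n : ℕ) (hn : 1 ≤ n)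
    (c : Fin (n + 1) → ℕ) (m : ℕ) (hm : m = ∑ i, c i)
    -- `lab` records the partition of the index set into blocks `G_0, …, G_n`
    (lab : Fin m → Fin (n + 1))
    (hlab : ∀ i : Fin (n + 1), (Finset.univ.filter fun r => lab r = i).card = c i)
    (A A' : Matrix (Fin m) (Fin m) ℤ_[p])
    -- every entry of a column indexed by `G_i` is divisible by `p^i`:
    (hA : ∀ r s, (p : ℤ_[p]) ^ ((lab s : ℕ)) ∣ A r s)
    (N : ℕ) (hN : n ≤ N)
    (hAA' : ∀ r s, (p : ℤ_[p]) ^ N ∣ (A r s - A' r s)) :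
    ∀ l : ℕ, 1 ≤ l → l ≤ m →
      (p : ℤ_[p]) ^ (N + hodgeGamma c (l - 1)) ∣
        ((revCharPoly A).coeff l - (revCharPoly A').coeff l) := by
  intro l hl _
  rw [aux_coeff, aux_coeff, ← mul_sub, ← Finset.sum_sub_distrib]
  refine Dvd.dvd.mul_left (Finset.dvd_sum fun s hs => ?_) _
  have hcard := (Finset.mem_powersetCard.mp hs).2
  rw [Matrix.det_apply, Matrix.det_apply, ← Finset.sum_sub_distrib]
  refine Finset.dvd_sum fun σ _ => ?_
  rw [← smul_sub, Units.smul_def, zsmul_eq_mul]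
  refine Dvd.dvd.mul_left ?_ _
  simp only [Matrix.submatrix_apply]
  refine aux_prod (p : ℤ_[p]) N (fun i : {x // x ∈ s} => (lab i.1 : ℕ)) ?_ _ _
    (fun i => hA _ _) (fun i => hAA' _ _) Finset.univ _ ?_
  · intro i
    have := (lab i.1).isLt
    show (lab i.1 : ℕ) ≤ N
    omega
  · intro j _
    have h := aux_gamma c m lab hlab (s.erase j.1)
    rw [Finset.card_erase_of_mem j.2, hcard] at h
    refine h.trans (le_of_eq ?_)
    have h1 := Finset.add_sum_erase s (fun i => (lab i : ℕ)) j.2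
    have h2 := Finset.add_sum_erase Finset.univ
      (fun i : {x // x ∈ s} => (lab i.1 : ℕ)) (Finset.mem_univ j)
    have h3 := Finset.sum_coe_sort s (fun i => (lab i : ℕ))
    omega
end

section
/- Let p be a prime, n ≥ 1, and fix nonnegative integers a_0,…,a_n and b_0,…,b_{n−1} with associated Hodge data (c_i, m, Γ, adaptedness) as in the context. Let A ∈ M_m(ℤ_p) be adapted to the Hodge structure and write det(1 − T·A) = Σ_{l=0}^m a_l T^l. Then for every 0 ≤ l ≤ m one has v_p(a_l) ≥ Γ(l). In other words, the Newton polygon of A lies on or above the Hodge polygon Γ of the pair. -/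
open scoped BigOperators

theorem take_sum_le_aux : ∀ (L t : List ℕ), L.Pairwise (· ≤ ·) → t.Sublist L →
    (L.take t.length).sum ≤ t.sum
  | _, [], _, _ => by simp
  | [], x :: t, _, h => by simp at h
  | y :: L, x :: t, hL, h => by
    have hx : x ∈ y :: L := h.subset (by simp)
    have ht : t.Sublist L := by
      cases h with
      | cons _ h => exact (List.sublist_cons_self _ _).trans h
      | cons_cons _ h => exact h
    rw [List.pairwise_cons] at hL
    have hyx : y ≤ x := by
      rcases List.mem_cons.1 hx with h | h
      · exact h.ge
      · exact hL.1 x h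
    have := take_sum_le_aux L t hL.2 ht
    simp only [List.length_cons, List.take_succ_cons, List.sum_cons]
    omega

theorem sort_take_sum_le_aux (M N : Multiset ℕ) (h : N ≤ M) :
    ((M.sort (· ≤ ·)).take N.card).sum ≤ N.sum := by
  have hs : (N.sort (· ≤ ·)).Sublist (M.sort (· ≤ ·)) := by
    apply List.sublist_of_subperm_of_pairwise (r := (· ≤ ·))
    · rw [← Multiset.coe_le]; simpa using h
    · exact Multiset.pairwise_sort _ _
    · exact Multiset.pairwise_sort _ _
  have := take_sum_le_aux _ _ (Multiset.pairwise_sort M (· ≤ ·)) hs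
  rw [Multiset.length_sort] at this
  refine this.trans (le_of_eq ?_)
  rw [← Multiset.sum_coe, Multiset.sort_eq]

/-- weight of a label -/
def labWeight {n : ℕ} : Fin (n + 1) ⊕ Fin n → ℕ
  | Sum.inl i => i
  | Sum.inr j => j + 1

theorem prod_dvd_aux {p : ℕ} [Fact p.Prime] {n : ℕ} {S : Type*} [Fintype S]
    (lab : S → Fin (n + 1) ⊕ Fin n) (A : Matrix S S ℤ_[p])
    (hA1 : ∀ r s (i : Fin (n + 1)), lab s = Sum.inl i → (p : ℤ_[p]) ^ (i : ℕ) ∣ A r s)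
    (hA2 : ∀ r s (j' j : Fin n), lab r = Sum.inr j' → lab s = Sum.inr j →
      (p : ℤ_[p]) ^ ((j : ℕ) + 1) ∣ A r s)
    (hA3 : ∀ r s (j : Fin n) (i : Fin (n + 1)), lab r = Sum.inr j → lab s = Sum.inl i →
      A r s = 0) (σ : Equiv.Perm S) :
    (p : ℤ_[p]) ^ (∑ s, labWeight (lab s)) ∣ ∏ s, A (σ s) s := by
  classical
  by_cases hz : ∃ s, (lab (σ s)).isRight ∧ (lab s).isLeft
  · obtain ⟨s, h1, h2⟩ := hz
    obtain ⟨j, hj⟩ := Sum.isRight_iff.1 h1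
    obtain ⟨i, hi⟩ := Sum.isLeft_iff.1 h2
    have h0 : ∏ s, A (σ s) s = 0 := Finset.prod_eq_zero (Finset.mem_univ s) (hA3 _ _ j i hj hi)
    rw [h0]
    exact dvd_zero _
  · push Not at hz
    have key : ∀ s, (lab s).isRight → (lab (σ s)).isRight := by
      let X : Finset S := Finset.univ.filter fun s => (lab s).isLeft
      have hX : X.map σ.toEmbedding = X := by
        apply Finset.eq_of_subset_of_card_le
        · intro t ht
          obtain ⟨s, hs, rfl⟩ := Finset.mem_map.1 ht
          have h1 : (lab s).isLeft := by simpa [X] using hs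
          have := fun h => hz s h h1
          simpa [X] using this
        · simp
      intro s hs
      by_contra hc
      have h1 : σ s ∈ X := by simpa [X] using hc
      rw [← hX] at h1
      have h2 : s ∈ X := by simpa using h1
      have h3 : (lab s).isLeft := by simpa [X] using h2
      cases h : lab s <;> simp [h] at hs h3
    rw [← Finset.prod_pow_eq_pow_sum]
    apply Finset.prod_dvd_prod_of_dvd
    intro s _
    rcases h : lab s with i | j
    · exact hA1 _ _ _ h
    · obtain ⟨j', hj'⟩ := Sum.isRight_iff.1 (key s (by simp [h]))
      exact hA2 _ _ j' j hj' h

/-- The Newton polygon of a matrix adapted to the Hodge structure of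
the pair `(X̄, D)` lies on or above the Hodge polygon `Γ`: the `l`-th coefficient of its
reverse characteristic polynomial is divisible by `p^(Γ(l))`. -/
theorem newton_above_hodge (p : ℕ) [Fact p.Prime] (n : ℕ) (hn : 1 ≤ n)
    (a : Fin (n + 1) → ℕ) (b : Fin n → ℕ) (c : Fin (n + 1) → ℕ)
    (hc0 : c 0 = a 0) (hc : ∀ i : Fin n, c i.succ = a i.succ + b i)
    (m : ℕ) (hm : m = ∑ i, c i)
    -- `lab` records the partition of the index set into the blocks `X_i` and `D_j`
    (lab : Fin m → Fin (n + 1) ⊕ Fin n)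
    (hlabX : ∀ i : Fin (n + 1),
      (Finset.univ.filter fun r => lab r = Sum.inl i).card = a i)
    (hlabD : ∀ j : Fin n,
      (Finset.univ.filter fun r => lab r = Sum.inr j).card = b j)
    (A : Matrix (Fin m) (Fin m) ℤ_[p])
    -- `A` is adapted to the Hodge structure:
    (hA1 : ∀ r s (i : Fin (n + 1)), lab s = Sum.inl i → (p : ℤ_[p]) ^ (i : ℕ) ∣ A r s)
    (hA2 : ∀ r s (j' j : Fin n), lab r = Sum.inr j' → lab s = Sum.inr j →
      (p : ℤ_[p]) ^ ((j : ℕ) + 1) ∣ A r s)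
    (hA3 : ∀ r s (j : Fin n) (i : Fin (n + 1)), lab r = Sum.inr j → lab s = Sum.inl i →
      A r s = 0) :
    ∀ l : ℕ, l ≤ m → (p : ℤ_[p]) ^ (hodgeGamma c l) ∣ (revCharPoly A).coeff l := by
  intro l hl
  have hM : (∑ i : Fin (n + 1), Multiset.replicate (c i) (i : ℕ)) =
      (Finset.univ : Finset (Fin m)).val.map (fun s => labWeight (lab s)) := by
    have e1 : (Finset.univ : Finset (Fin m)).val.map lab =
        (∑ i, Multiset.replicate (a i) (Sum.inl i)) +
          ∑ j, Multiset.replicate (b j) (Sum.inr j) := by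
      ext x
      rw [Multiset.count_map, Multiset.count_add, Multiset.count_sum', Multiset.count_sum']
      rcases x with i | j
      · simp only [Multiset.count_replicate]
        simp [← hlabX, Finset.card_def, eq_comm]
      · simp only [Multiset.count_replicate]
        simp [← hlabD, Finset.card_def, eq_comm]
    rw [← Function.comp_def, ← Multiset.map_map, e1, ← Multiset.coe_mapAddMonoidHom,
      map_add, map_sum, map_sum]
    simp only [Multiset.coe_mapAddMonoidHom]
    simp only [Multiset.map_replicate, labWeight]
    rw [Fin.sum_univ_succ, Fin.sum_univ_succ (n := n)]
    simp only [hc0, hc, Multiset.replicate_add, Finset.sum_add_distrib, Fin.val_succ]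
    rw [add_assoc]
  have hrev : revCharPoly A =
      (1 + (Polynomial.X : Polynomial ℤ_[p]) • (-A).map Polynomial.C).det := by
    unfold revCharPoly
    congr 1
    ext i j : 2
    simp [sub_eq_add_neg]
  rw [hrev, Matrix.coeff_det_one_add_X_smul_eq_sum_minors]
  apply Finset.dvd_sum
  intro S hS
  have hcard : S.card = l := (Finset.mem_powersetCard.1 hS).2
  have hle : hodgeGamma c l ≤ ∑ s : S, labWeight (lab s) := by
    have := sort_take_sum_le_aux ((Finset.univ : Finset (Fin m)).val.map
      (fun s => labWeight (lab s))) (S.val.map (fun s => labWeight (lab s)))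
      (Multiset.map_le_map (Finset.val_le_iff.2 (Finset.subset_univ S)))
    rw [Multiset.card_map, ← Finset.card_def, hcard] at this
    unfold hodgeGamma
    rw [hM]
    refine this.trans (le_of_eq ?_)
    exact (Finset.sum_coe_sort S (fun s => labWeight (lab s))).symm
  refine (pow_dvd_pow _ hle).trans ?_
  rw [Matrix.det_apply']
  apply Finset.dvd_sum
  intro σ _
  apply Dvd.dvd.mul_left
  exact prod_dvd_aux (fun s : S => lab s) ((-A).submatrix _ _)
    (fun r s i h => by simpa using hA1 r s i h)
    (fun r s j' j h h' => by simpa using hA2 r s j' j h h')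
    (fun r s j i h h' => by simpa using hA3 r s j i h h') σ
end

section
/- Let p be a prime, n ≥ 1, and fix nonnegative integers a_0,…,a_n and b_0,…,b_{n−1} with associated Hodge data (c_i, m, Γ, adaptedness) as in the context. Let c ≥ 0 and N be integers with N ≥ 2(n+1) + c. Let A ∈ M_m(ℤ_p) be adapted to the Hodge structure, and let U ∈ M_m(ℤ_p) be invertible over ℚ_p with all entries of p^c·U^{−1} lying in ℤ_p. Set B = U A U^{−1} ∈ M_m(ℚ_p), and let B̃ ∈ M_m(ℚ_p) satisfy v_p(B_{rs} − B̃_{rs}) ≥ N for all r, s. Write det(1 − T·B) = Σ_{l=0}^m b_l T^l and det(1 − T·B̃) = Σ_{l=0}^m b̃_l T^l. Then for every 0 ≤ l ≤ m one has v_p(b_l − b̃_l) ≥ (N − c) + Γ(max(l−2, 0)). -/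
open scoped BigOperators

noncomputable def plcW {n m : ℕ} (lab : Fin m → Fin (n + 1) ⊕ Fin n) (r : Fin m) : ℕ :=
  Sum.elim (fun i : Fin (n + 1) => (i : ℕ)) (fun j : Fin n => (j : ℕ) + 1) (lab r)

theorem plc_revCharPoly_conj {m : ℕ} {K : Type*} [CommRing K]
    (U V A : Matrix (Fin m) (Fin m) K) (h : U * V = 1) :
    revCharPoly (U * A * V) = revCharPoly A := by
  unfold revCharPoly
  have h1 : U.map (Polynomial.C : K →+* Polynomial K) * V.map (Polynomial.C : K →+* Polynomial K)
      = 1 := by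
    rw [← Matrix.map_mul, h]; simp
  have h2 : (1 - (Polynomial.X : Polynomial K) • (U * A * V).map (Polynomial.C : K →+* Polynomial K))
      = U.map (Polynomial.C : K →+* Polynomial K) *
        (1 - (Polynomial.X : Polynomial K) • A.map (Polynomial.C : K →+* Polynomial K)) *
        V.map (Polynomial.C : K →+* Polynomial K) := by
    rw [mul_sub, sub_mul, mul_one, h1, Matrix.map_mul, Matrix.map_mul]
    simp
  rw [h2, Matrix.det_mul, Matrix.det_mul, mul_right_comm, ← Matrix.det_mul, h1]
  simp

theorem plc_coeff {m : ℕ} {K : Type*} [CommRing K] (A : Matrix (Fin m) (Fin m) K) (l : ℕ) :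
    (revCharPoly A).coeff l = ∑ σ : Equiv.Perm (Fin m), ∑ t ∈ Finset.powersetCard l Finset.univ,
      ((Equiv.Perm.sign σ : ℤ) : K) * ((∏ i ∈ t, -A (σ i) i) *
        ∏ i ∈ Finset.univ \ t, (1 : Matrix (Fin m) (Fin m) K) (σ i) i) := by
  unfold revCharPoly
  rw [Matrix.det_apply', Polynomial.finsetSum_coeff]
  refine Finset.sum_congr rfl fun σ _ => ?_
  have h1 : ∏ i, (1 - (Polynomial.X : Polynomial K) • A.map Polynomial.C) (σ i) i
      = ∑ t ∈ (Finset.univ : Finset (Fin m)).powerset, Polynomial.C ((∏ i ∈ t, -A (σ i) i) *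
        ∏ i ∈ Finset.univ \ t, (1 : Matrix (Fin m) (Fin m) K) (σ i) i) * Polynomial.X ^ t.card := by
    have : ∀ i, (1 - (Polynomial.X : Polynomial K) • A.map Polynomial.C) (σ i) i
        = Polynomial.C (-A (σ i) i) * Polynomial.X
          + Polynomial.C ((1 : Matrix (Fin m) (Fin m) K) (σ i) i) := by
      intro i
      simp only [Matrix.sub_apply, Matrix.smul_apply, Matrix.map_apply, Matrix.one_apply]
      split_ifs <;> simp <;> ring
    rw [Finset.prod_congr rfl fun i _ => this i, Finset.prod_add]
    refine Finset.sum_congr rfl fun t _ => ?_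
    rw [Finset.prod_mul_distrib, Finset.prod_const, Polynomial.C_mul, map_prod, map_prod]
    ring
  have h2 : (((Equiv.Perm.sign σ : ℤ)) : Polynomial K)
      = Polynomial.C (((Equiv.Perm.sign σ : ℤ)) : K) := by simp
  rw [h1, h2, Polynomial.coeff_C_mul, Polynomial.finsetSum_coeff, Finset.mul_sum]
  simp only [Polynomial.coeff_C_mul_X_pow]
  rw [← Finset.sum_subset (show Finset.powersetCard l (Finset.univ : Finset (Fin m)) ⊆ Finset.univ.powerset from
    fun t _ => Finset.mem_powerset.2 (Finset.subset_univ t))]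
  · refine Finset.sum_congr rfl fun t ht => ?_
    rw [if_pos (Finset.mem_powersetCard.1 ht).2.symm]
  · intro t _ ht
    rw [if_neg, mul_zero]
    intro h
    exact ht (Finset.mem_powersetCard.2 ⟨Finset.subset_univ _, h.symm⟩)

theorem plc_perm_card {m : ℕ} (σ : Equiv.Perm (Fin m)) (P : Fin m → Prop) [DecidablePred P] :
    (Finset.univ.filter fun i => P (σ i) ∧ ¬ P i).card
      = (Finset.univ.filter fun i => ¬ P (σ i) ∧ P i).card := by
  have h1 : (Finset.univ.filter fun i => P (σ i)).card = (Finset.univ.filter fun i => P i).card := by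
    refine Finset.card_bij (fun i _ => σ i) ?_ ?_ ?_
    · intro i hi; simpa using hi
    · intro i _ j _ h; exact σ.injective h
    · intro j hj; exact ⟨σ.symm j, by simpa using hj, by simp⟩
  have h2 := Finset.card_filter_add_card_filter_not (s := Finset.univ.filter fun i => P (σ i)) P
  have h3 := Finset.card_filter_add_card_filter_not (s := Finset.univ.filter fun i => P i)
    (fun i => P (σ i))
  simp only [Finset.filter_filter] at h2 h3
  have h4 : (Finset.univ.filter fun i => P (σ i) ∧ P i)
    = (Finset.univ.filter fun i => P i ∧ P (σ i)) := by
    ext i; simp [and_comm]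
  have h5 : (Finset.univ.filter fun i => ¬ P (σ i) ∧ P i)
    = (Finset.univ.filter fun i => P i ∧ ¬ P (σ i)) := by
    ext i; simp [and_comm]
  rw [h4] at h2
  rw [h5]
  omega

theorem plc_core {n m p : ℕ} [Fact p.Prime] {q : ℝ} (hq0 : 0 ≤ q) (hq1 : q ≤ 1)
    (A F : Matrix (Fin m) (Fin m) ℚ_[p]) (P : Fin m → Prop) [DecidablePred P]
    (w : Fin m → ℕ) (Γ : ℕ → ℕ) (M : ℕ) (hM : 2 * (n + 1) ≤ M)
    (hA0 : ∀ r s, ‖A r s‖ ≤ 1)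
    (hA : ∀ r s, ¬ (P r ∧ ¬ P s) → ‖A r s‖ ≤ q ^ w s)
    (hAz : ∀ r s, ¬ P r → P s → A r s = 0)
    (hmono : ∀ i j, i ≤ j → Γ i ≤ Γ j)
    (hF : ∀ r s, ‖F r s‖ ≤ q ^ M)
    (hstep : ∀ j d, Γ (j + d) ≤ Γ j + d * n)
    (hle : ∀ G : Finset (Fin m), Γ G.card ≤ ∑ i ∈ G, w i) (l : ℕ) :
    ‖(revCharPoly (A + F)).coeff l - (revCharPoly A).coeff l‖ ≤ q ^ (M + Γ (l - 2)) := by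
  classical
  have hR : 0 ≤ q ^ (M + Γ (l - 2)) := by positivity
  rw [plc_coeff, plc_coeff, ← Finset.sum_sub_distrib]
  refine IsUltrametricDist.norm_sum_le_of_forall_le_of_nonneg hR fun σ _ => ?_
  rw [← Finset.sum_sub_distrib]
  refine IsUltrametricDist.norm_sum_le_of_forall_le_of_nonneg hR fun t ht => ?_
  have htc : t.card = l := (Finset.mem_powersetCard.1 ht).2
  rw [← mul_sub, ← sub_mul, norm_mul]
  refine (mul_le_of_le_one_left (norm_nonneg _) (Padic.norm_int_le_one _)).trans ?_
  by_cases hfix : ∀ i, i ∉ t → σ i = i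
  swap
  · push Not at hfix
    obtain ⟨i, hi, hne⟩ := hfix
    have : ∏ i ∈ Finset.univ \ t, (1 : Matrix (Fin m) (Fin m) ℚ_[p]) (σ i) i = 0 :=
      Finset.prod_eq_zero (i := i) (by simp [hi]) (by simp [Matrix.one_apply, hne])
    rw [this, mul_zero, norm_zero]; exact hR
  have : ∏ i ∈ Finset.univ \ t, (1 : Matrix (Fin m) (Fin m) ℚ_[p]) (σ i) i = 1 :=
    Finset.prod_eq_one fun i hi => by
      rw [hfix i (by simpa using hi)]; simp
  rw [this, mul_one]
  have hexp : ∏ i ∈ t, -(A + F) (σ i) i - ∏ i ∈ t, -A (σ i) i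
      = ∑ u ∈ t.powerset.erase ∅, (∏ i ∈ u, -F (σ i) i) * ∏ i ∈ t \ u, -A (σ i) i := by
    have h : ∏ i ∈ t, -(A + F) (σ i) i = ∏ i ∈ t, (-F (σ i) i + -A (σ i) i) :=
      Finset.prod_congr rfl fun i _ => by simp [Matrix.add_apply]; try ring
    rw [h, Finset.prod_add, ← Finset.add_sum_erase _ _ (Finset.empty_mem_powerset t)]
    simp
  rw [hexp]
  refine IsUltrametricDist.norm_sum_le_of_forall_le_of_nonneg hR fun u hu => ?_
  obtain ⟨hune, hut⟩ := Finset.mem_erase.1 hu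
  rw [Finset.mem_powerset] at hut
  have hk : 1 ≤ u.card := Finset.card_pos.2 (Finset.nonempty_iff_ne_empty.2 hune)
  set Q := Finset.univ.filter fun i => P (σ i) ∧ ¬ P i with hQ
  set Q' := Finset.univ.filter fun i => ¬ P (σ i) ∧ P i with hQ'
  have hQQ : Q.card = Q'.card := plc_perm_card σ P
  by_cases hsub : Q' ⊆ u
  swap
  · obtain ⟨i, hi, hiu⟩ := Finset.not_subset.1 hsub
    have hi2 : ¬ P (σ i) ∧ P i := by simpa [hQ'] using hi
    have hit : i ∈ t := by
      by_contra h
      rw [hfix i h] at hi2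
      exact hi2.1 hi2.2
    rw [Finset.prod_eq_zero (i := i) (s := t \ u) (by simp [hit, hiu])
      (by rw [hAz _ _ hi2.1 hi2.2, neg_zero])]
    simpa using hR
  have hQc : Q.card ≤ u.card := hQQ ▸ Finset.card_le_card hsub
  set G := (t \ u) \ Q with hG
  have hGc : l ≤ G.card + 2 * u.card := by
    have h1 := Finset.le_card_sdiff Q (t \ u)
    have h2 := Finset.le_card_sdiff u t
    rw [← hG] at h1
    omega
  have hFb : ‖∏ i ∈ u, -F (σ i) i‖ ≤ q ^ (u.card * M) := by
    rw [norm_prod, mul_comm, pow_mul, ← Finset.prod_const]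
    exact Finset.prod_le_prod (fun _ _ => norm_nonneg _) fun i _ => by rw [norm_neg]; exact hF _ _
  have hAb : ‖∏ i ∈ t \ u, -A (σ i) i‖ ≤ q ^ (∑ i ∈ G, w i) := by
    rw [norm_prod, ← Finset.prod_sdiff (Finset.sdiff_subset : G ⊆ t \ u), ← Finset.prod_pow_eq_pow_sum]
    have h1 : ∏ i ∈ (t \ u) \ G, ‖-A (σ i) i‖ ≤ 1 :=
      Finset.prod_le_one (fun _ _ => norm_nonneg _) fun i _ => by rw [norm_neg]; exact hA0 _ _
    have h2 : ∏ i ∈ G, ‖-A (σ i) i‖ ≤ ∏ i ∈ G, q ^ w i :=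
      Finset.prod_le_prod (fun _ _ => norm_nonneg _) fun i hi => by
        rw [norm_neg]
        apply hA
        have := (Finset.mem_sdiff.1 hi).2
        simpa only [hQ, Finset.mem_filter, Finset.mem_univ, true_and] using this
    exact (mul_le_of_le_one_left (Finset.prod_nonneg fun _ _ => norm_nonneg _) h1).trans h2
  rw [norm_mul]
  refine (mul_le_mul hFb hAb (norm_nonneg _) (by positivity)).trans ?_
  rw [← pow_add]
  refine pow_le_pow_of_le_one hq0 hq1 ?_
  have hg := hle G
  obtain ⟨k, hk'⟩ := Nat.exists_eq_add_of_le hk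
  have h3 : Γ (l - 2) ≤ Γ G.card + (2 * k) * n := by
    have h4 := hstep G.card (2 * k)
    exact (hmono _ _ (by omega)).trans h4
  rw [hk']
  nlinarith [Nat.mul_le_mul_left k hM]

theorem plc_gamma_step {n : ℕ} (c : Fin (n + 1) → ℕ) (j d : ℕ) :
    hodgeGamma c (j + d) ≤ hodgeGamma c j + d * n := by
  unfold hodgeGamma
  set L := (∑ i : Fin (n + 1), Multiset.replicate (c i) (i : ℕ)).sort (· ≤ ·) with hL
  rw [List.take_add, List.sum_append]
  refine Nat.add_le_add_left ?_ _
  have h := List.sum_le_card_nsmul ((L.drop j).take d) n (by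
    intro x hx
    have hx' := List.mem_of_mem_drop (List.mem_of_mem_take hx)
    rw [hL, Multiset.mem_sort, Multiset.mem_sum] at hx'
    obtain ⟨i, _, hi⟩ := hx'
    rw [Multiset.eq_of_mem_replicate hi]
    omega)
  refine h.trans ?_
  rw [smul_eq_mul]
  exact Nat.mul_le_mul_right _ (List.length_take_le _ _)

theorem plc_gamma_mono {n : ℕ} (c : Fin (n + 1) → ℕ) (i j : ℕ) (h : i ≤ j) :
    hodgeGamma c i ≤ hodgeGamma c j := by
  unfold hodgeGamma
  obtain ⟨d, rfl⟩ := Nat.exists_eq_add_of_le h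
  rw [List.take_add, List.sum_append]
  exact Nat.le_add_right _ _

theorem plc_sublist (L s : List ℕ) (hs : s.Sublist L) (hL : L.Pairwise (· ≤ ·)) :
    (L.take s.length).sum ≤ s.sum := by
  induction hs with
  | slnil => simp
  | @cons s L x h ih =>
    rw [List.pairwise_cons] at hL
    refine le_trans ?_ (ih hL.2)
    have hlen := h.length_le
    rcases hk : s.length with _ | k
    · simp
    · have hkL : k < L.length := by omega
      rw [List.take_succ_cons, List.sum_cons, List.take_succ_eq_append_getElem hkL, List.sum_append]
      have := hL.1 _ (List.getElem_mem hkL)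
      simp
      omega
  | @cons_cons s L x h ih =>
    rw [List.pairwise_cons] at hL
    have := ih hL.2
    simp
    omega

theorem plc_gamma_le {m : ℕ} (w : Fin m → ℕ) (G : Finset (Fin m)) :
    ((((Finset.univ : Finset (Fin m)).val.map w).sort (· ≤ ·)).take G.card).sum
      ≤ ∑ i ∈ G, w i := by
  have hle : G.val.map w ≤ (Finset.univ : Finset (Fin m)).val.map w :=
    Multiset.map_le_map (Finset.val_le_iff.2 (Finset.subset_univ G))
  have hsp : List.Subperm ((G.val.map w).sort (· ≤ ·))
      (((Finset.univ : Finset (Fin m)).val.map w).sort (· ≤ ·)) := by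
    rw [← Multiset.coe_le, Multiset.sort_eq, Multiset.sort_eq]; exact hle
  have hsub := List.sublist_of_subperm_of_pairwise hsp (Multiset.pairwise_sort _ _)
    (Multiset.pairwise_sort _ _)
  have h := plc_sublist _ _ hsub (Multiset.pairwise_sort _ _)
  rw [Multiset.length_sort, Multiset.card_map, ← Multiset.sum_coe ((G.val.map w).sort (· ≤ ·)),
    Multiset.sort_eq] at h
  exact h

theorem plc_weights {n m : ℕ} (a : Fin (n + 1) → ℕ) (b : Fin n → ℕ) (c : Fin (n + 1) → ℕ)
    (hc0 : c 0 = a 0) (hc : ∀ i : Fin n, c i.succ = a i.succ + b i)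
    (lab : Fin m → Fin (n + 1) ⊕ Fin n)
    (hlabX : ∀ i : Fin (n + 1),
      (Finset.univ.filter fun r => lab r = Sum.inl i).card = a i)
    (hlabD : ∀ j : Fin n,
      (Finset.univ.filter fun r => lab r = Sum.inr j).card = b j) :
    (Finset.univ : Finset (Fin m)).val.map (plcW lab)
      = ∑ i : Fin (n + 1), Multiset.replicate (c i) (i : ℕ) := by
  classical
  have h1 : (Finset.univ : Finset (Fin m)).val.map (plcW lab)
      = ∑ r : Fin m, ({plcW lab r} : Multiset ℕ) := by
    rw [Finset.sum, ← Multiset.sum_map_singleton (Multiset.map _ _), Multiset.map_map]; rfl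
  have h2 : ∑ r : Fin m, ({plcW lab r} : Multiset ℕ)
      = ∑ x : Fin (n + 1) ⊕ Fin n, (Finset.univ.filter fun r => lab r = x).card •
        ({Sum.elim (fun i : Fin (n + 1) => (i : ℕ)) (fun j : Fin n => (j : ℕ) + 1) x} : Multiset ℕ) := by
    rw [← Finset.sum_fiberwise Finset.univ lab]
    refine Finset.sum_congr rfl fun x _ => ?_
    rw [← Finset.sum_const]
    refine Finset.sum_congr rfl fun r hr => ?_
    rw [plcW, (Finset.mem_filter.1 hr).2]
  rw [h1, h2, Fintype.sum_sum_type, Fin.sum_univ_succ, Fin.sum_univ_succ]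
  simp only [hlabX, hlabD, hc0, hc, Sum.elim_inl, Sum.elim_inr, ← Multiset.nsmul_singleton,
    add_smul, Finset.sum_add_distrib, Fin.val_succ]
  rw [add_assoc]

/-- Main precision-loss theorem: `A` is adapted to the Hodge structure,
`U` is a change of basis with `p^e · U⁻¹` integral, `B = U A U⁻¹`, and `B'` approximates
`B` modulo `p^N` with `N ≥ 2(n+1) + e`.  Then the `l`-th coefficients of the reverse
characteristic polynomials of `B` and `B'` agree modulo `p^((N - e) + Γ(max(l-2,0)))`. -/
theorem precision_loss_conjugated (p : ℕ) [Fact p.Prime] (n : ℕ) (hn : 1 ≤ n)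
    (a : Fin (n + 1) → ℕ) (b : Fin n → ℕ) (c : Fin (n + 1) → ℕ)
    (hc0 : c 0 = a 0) (hc : ∀ i : Fin n, c i.succ = a i.succ + b i)
    (m : ℕ) (hm : m = ∑ i, c i)
    -- `lab` records the partition of the index set into the blocks `X_i` and `D_j`
    (lab : Fin m → Fin (n + 1) ⊕ Fin n)
    (hlabX : ∀ i : Fin (n + 1),
      (Finset.univ.filter fun r => lab r = Sum.inl i).card = a i)
    (hlabD : ∀ j : Fin n,
      (Finset.univ.filter fun r => lab r = Sum.inr j).card = b j)
    (A : Matrix (Fin m) (Fin m) ℤ_[p])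
    -- `A` is adapted to the Hodge structure:
    (hA1 : ∀ r s (i : Fin (n + 1)), lab s = Sum.inl i → (p : ℤ_[p]) ^ (i : ℕ) ∣ A r s)
    (hA2 : ∀ r s (j' j : Fin n), lab r = Sum.inr j' → lab s = Sum.inr j →
      (p : ℤ_[p]) ^ ((j : ℕ) + 1) ∣ A r s)
    (hA3 : ∀ r s (j : Fin n) (i : Fin (n + 1)), lab r = Sum.inr j → lab s = Sum.inl i →
      A r s = 0)
    (e N : ℕ) (hN : 2 * (n + 1) + e ≤ N)
    (U : Matrix (Fin m) (Fin m) ℤ_[p])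
    -- `U` is invertible over `ℚ_p`:
    (hU : IsUnit (U.map ((↑) : ℤ_[p] → ℚ_[p])).det)
    -- all entries of `p^e • U⁻¹` are `p`-adic integers:
    (hUinv : ∀ r s, ‖(p : ℚ_[p]) ^ e * (U.map ((↑) : ℤ_[p] → ℚ_[p]))⁻¹ r s‖ ≤ 1)
    (B B' : Matrix (Fin m) (Fin m) ℚ_[p])
    (hB : B = U.map ((↑) : ℤ_[p] → ℚ_[p]) * A.map ((↑) : ℤ_[p] → ℚ_[p]) *
      (U.map ((↑) : ℤ_[p] → ℚ_[p]))⁻¹)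
    (hBB' : ∀ r s, ‖B r s - B' r s‖ ≤ (p : ℝ) ^ (-(N : ℤ))) :
    ∀ l : ℕ, l ≤ m →
      ‖(revCharPoly B).coeff l - (revCharPoly B').coeff l‖ ≤
        (p : ℝ) ^ (-(((N : ℤ) - (e : ℤ)) + (hodgeGamma c (l - 2) : ℤ))) := by
  classical
  intro l hl
  set Uq := U.map ((↑) : ℤ_[p] → ℚ_[p]) with hUq
  set Aq := A.map ((↑) : ℤ_[p] → ℚ_[p]) with hAq
  have hUV : Uq * Uq⁻¹ = 1 := Matrix.mul_nonsing_inv _ hU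
  have hVU : Uq⁻¹ * Uq = 1 := Matrix.nonsing_inv_mul _ hU
  have hp0 : (0 : ℝ) < p := by exact_mod_cast (Fact.out : p.Prime).pos
  have hp1 : (1 : ℝ) ≤ p := by exact_mod_cast (Fact.out : p.Prime).one_lt.le
  set F := Uq⁻¹ * (B' - B) * Uq with hF
  have hB'' : B' = Uq * (Aq + F) * Uq⁻¹ := by
    have h1 : Uq * (Aq + F) * Uq⁻¹ =
        Uq * Aq * Uq⁻¹ + (Uq * Uq⁻¹) * (B' - B) * (Uq * Uq⁻¹) := by
      rw [hF]; noncomm_ring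
    rw [h1, hUV, ← hB]; simp
  rw [hB'', hB, plc_revCharPoly_conj _ _ _ hUV, plc_revCharPoly_conj _ _ _ hUV]
  have hM : (-((N : ℤ) - (e : ℤ) + (hodgeGamma c (l - 2) : ℤ)))
      = -(((N - e) + hodgeGamma c (l - 2) : ℕ) : ℤ) := by
    push_cast [Nat.cast_sub (show e ≤ N by omega)]; ring
  have hpow : ∀ k : ℕ, (p : ℝ) ^ (-(k : ℤ)) = ((p : ℝ)⁻¹) ^ k := by
    intro k; rw [zpow_neg, zpow_natCast, inv_pow]
  rw [hM, hpow, norm_sub_rev]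
  have hV : ∀ r s, ‖Uq⁻¹ r s‖ ≤ (p : ℝ) ^ e := by
    intro r s
    have h := hUinv r s
    rw [norm_mul, norm_pow, Padic.norm_p, inv_pow, inv_mul_le_iff₀ (by positivity)] at h
    simpa using h
  have hFn : ∀ r s, ‖F r s‖ ≤ ((p : ℝ)⁻¹) ^ (N - e) := by
    intro r s
    rw [hF, Matrix.mul_apply]
    refine IsUltrametricDist.norm_sum_le_of_forall_le_of_nonneg (by positivity) ?_
    intro j _
    rw [norm_mul]
    have h1 : ‖Uq j s‖ ≤ 1 := PadicInt.norm_le_one (U j s)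
    refine (mul_le_of_le_one_right (norm_nonneg _) h1).trans ?_
    rw [Matrix.mul_apply]
    refine IsUltrametricDist.norm_sum_le_of_forall_le_of_nonneg (by positivity) ?_
    intro k _
    rw [norm_mul, Matrix.sub_apply, norm_sub_rev]
    have h2 := hBB' k j
    rw [hpow] at h2
    refine (mul_le_mul (hV r k) h2 (norm_nonneg _) (by positivity)).trans (le_of_eq ?_)
    obtain ⟨d, rfl⟩ := Nat.exists_eq_add_of_le (show e ≤ N by omega)
    rw [Nat.add_sub_cancel_left, pow_add, ← mul_assoc, ← mul_pow, mul_inv_cancel₀ hp0.ne']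
    simp
  have hdvd : ∀ r s (k : ℕ), (p : ℤ_[p]) ^ k ∣ A r s → ‖Aq r s‖ ≤ ((p : ℝ)⁻¹) ^ k := by
    intro r s k h
    obtain ⟨x, hx⟩ := h
    have : ‖Aq r s‖ = ‖A r s‖ := rfl
    rw [this, hx, norm_mul, norm_pow, PadicInt.norm_p]
    exact mul_le_of_le_one_right (by positivity) (PadicInt.norm_le_one x)
  refine plc_core (n := n) (q := (p : ℝ)⁻¹) (by positivity) (inv_le_one_of_one_le₀ hp1) Aq F
    (fun r => (lab r).isLeft = true) (plcW lab) (hodgeGamma c) (N - e) (by omega)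
    ?_ ?_ ?_ ?_ hFn ?_ ?_ l
  · intro r s
    exact PadicInt.norm_le_one (A r s)
  · intro r s hrs
    apply hdvd
    rcases hs : lab s with i | j
    · simpa [plcW, hs] using hA1 r s i hs
    · rcases hr : lab r with i' | j'
      · simp [hr, hs] at hrs
      · simpa [plcW, hs] using hA2 r s j' j hr hs
  · intro r s hr hs
    rcases hs' : lab s with i | j
    · rcases hr' : lab r with i' | j'
      · simp [hr'] at hr
      · change ((A r s : ℤ_[p]) : ℚ_[p]) = 0
        rw [hA3 r s j' i hr' hs']; rfl
    · simp [hs'] at hs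
  · exact plc_gamma_mono c
  · intro j d
    exact plc_gamma_step c j d
  · intro G
    have h := plc_weights a b c hc0 hc lab hlabX hlabD
    unfold hodgeGamma
    rw [← h]
    exact plc_gamma_le _ G
end

section
/- Let p be a prime, m ≥ 1, and let N be a positive integer. Let (v_{rs}) be an m×m array of nonnegative integers with v_{rs} ≤ N for all r, s. Let A, Ã ∈ M_m(ℤ_p) satisfy v_p(A_{rs}) ≥ v_{rs} and v_p(A_{rs} − Ã_{rs}) ≥ N for all r, s. Write det(1 − T·A) = Σ_{l=0}^m a_l T^l and det(1 − T·Ã) = Σ_{l=0}^m ã_l T^l. Then for every 1 ≤ l ≤ m, v_p(a_l − ã_l) ≥ N + min over all choices of indices 1 ≤ u_1 < u_2 < … < u_l ≤ m and permutations τ of {1,…,l} of the quantity (Σ_{i=1}^l v_{u_i, u_{τ(i)}} − max_{1 ≤ i ≤ l} v_{u_i, u_{τ(i)}}). -/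
open scoped BigOperators

theorem prod_sub_prod_dvd_aux {R ι : Type*} [CommRing R] [DecidableEq ι] (q : R) (N : ℕ)
    (v : ι → ℕ) (a b : ι → R) (hv : ∀ i, v i ≤ N) (ha : ∀ i, q ^ v i ∣ a i)
    (hab : ∀ i, q ^ N ∣ a i - b i) (S : Finset ι) :
    ∀ e : ℕ, (∀ j ∈ S, e + v j ≤ N + ∑ i ∈ S, v i) →
      q ^ e ∣ ∏ i ∈ S, a i - ∏ i ∈ S, b i := by
  have hb : ∀ i, q ^ v i ∣ b i := fun i => by
    have h := dvd_sub (ha i) ((pow_dvd_pow q (hv i)).trans (hab i))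
    simpa using h
  induction S using Finset.induction_on with
  | empty => intro e _; simp
  | insert k S hk ih =>
    intro e he
    rw [Finset.prod_insert hk, Finset.prod_insert hk]
    have hkey : a k * ∏ i ∈ S, a i - b k * ∏ i ∈ S, b i =
        a k * (∏ i ∈ S, a i - ∏ i ∈ S, b i) + (a k - b k) * ∏ i ∈ S, b i := by ring
    rw [hkey]
    rw [Finset.sum_insert hk] at he
    apply dvd_add
    · have h1 := ih (e - v k) (fun j hj => by
        have h2 := he j (Finset.mem_insert_of_mem hj)
        have h3 := hv j
        omega)
      have h4 := mul_dvd_mul (ha k) h1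
      rw [← pow_add] at h4
      exact (pow_dvd_pow q (by omega)).trans h4
    · have h5 : q ^ (∑ i ∈ S, v i) ∣ ∏ i ∈ S, b i := by
        rw [← Finset.prod_pow_eq_pow_sum]
        exact Finset.prod_dvd_prod_of_dvd _ _ (fun i _ => hb i)
      have h4 := mul_dvd_mul (hab k) h5
      rw [← pow_add] at h4
      have h6 := he k (Finset.mem_insert_self k S)
      exact (pow_dvd_pow q (by omega)).trans h4

theorem revCharPoly_coeff_aux {m : ℕ} {R : Type*} [CommRing R]
    (A : Matrix (Fin m) (Fin m) R) (l : ℕ) :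
    (revCharPoly A).coeff l = (-1) ^ l * ∑ s ∈ Finset.univ.powersetCard l,
      (A.submatrix (Subtype.val : s → Fin m) (Subtype.val : s → Fin m)).det := by
  have h : revCharPoly A = Matrix.det (1 + (Polynomial.X : Polynomial R) •
      (-A).map Polynomial.C) := by
    simp only [revCharPoly, sub_eq_add_neg]
    congr 2
    rw [Matrix.map_neg Polynomial.C (map_neg Polynomial.C) A, smul_neg]
  rw [h, Matrix.coeff_det_one_add_X_smul_eq_sum_minors]
  simp only [Matrix.submatrix_neg, Pi.neg_apply, Matrix.det_neg, Fintype.card_coe, Finset.mul_sum]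
  exact Finset.sum_congr rfl fun s hs => by rw [(Finset.mem_powersetCard.mp hs).2]

/-- General entrywise precision-loss estimate: if `v_p(A r s) ≥ V r s`
with `V r s ≤ N` and `A' ≡ A mod p^N`, then for `1 ≤ l ≤ m` the `l`-th coefficients of
the reverse characteristic polynomials agree modulo `p^(N + μ_l)`, where `μ_l` is the
minimum over all choices of indices `u_1 < … < u_l` and permutations `τ` of
`Σ_i V(u_i, u_{τ(i)}) - max_i V(u_i, u_{τ(i)})`. -/
theorem precision_loss_entrywise (p : ℕ) [Fact p.Prime] (m : ℕ) (hm : 1 ≤ m)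
    (N : ℕ) (hN : 1 ≤ N)
    (V : Fin m → Fin m → ℕ) (hV : ∀ r s, V r s ≤ N)
    (A A' : Matrix (Fin m) (Fin m) ℤ_[p])
    (hA : ∀ r s, (p : ℤ_[p]) ^ (V r s) ∣ A r s)
    (hAA' : ∀ r s, (p : ℤ_[p]) ^ N ∣ (A r s - A' r s)) :
    ∀ l : ℕ, 1 ≤ l → l ≤ m →
      (p : ℤ_[p]) ^ (N + sInf {t : ℕ | ∃ (u : Fin l → Fin m) (τ : Equiv.Perm (Fin l)),
          StrictMono u ∧
          t = (∑ i, V (u i) (u (τ i))) - Finset.univ.sup fun i => V (u i) (u (τ i))}) ∣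
        ((revCharPoly A).coeff l - (revCharPoly A').coeff l) := by
  intro l hl hlm
  rw [revCharPoly_coeff_aux, revCharPoly_coeff_aux, ← mul_sub, ← Finset.sum_sub_distrib]
  apply Dvd.dvd.mul_left
  apply Finset.dvd_sum
  intro s hs
  have hc : s.card = l := (Finset.mem_powersetCard.mp hs).2
  let f := s.orderIsoOfFin hc
  have hd : ∀ B : Matrix (Fin m) (Fin m) ℤ_[p],
      (B.submatrix (Subtype.val : s → Fin m) (Subtype.val : s → Fin m)).det =
      ∑ τ : Equiv.Perm (Fin l), ((Equiv.Perm.sign τ : ℤ) : ℤ_[p]) *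
        ∏ i, B (f i) (f (τ i)) := by
    intro B
    rw [← Matrix.det_submatrix_equiv_self f.toEquiv, ← Matrix.det_transpose, Matrix.det_apply']
    rfl
  rw [hd, hd, ← Finset.sum_sub_distrib]
  apply Finset.dvd_sum
  intro τ _
  rw [← mul_sub]
  apply Dvd.dvd.mul_left
  apply prod_sub_prod_dvd_aux (p : ℤ_[p]) N (fun i => V (f i) (f (τ i)))
    _ _ (fun i => hV _ _) (fun i => hA _ _) (fun i => hAA' _ _)
  intro j _
  have h1 := Nat.sInf_le (s := {t : ℕ | ∃ (u : Fin l → Fin m) (τ : Equiv.Perm (Fin l)),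
          StrictMono u ∧
          t = (∑ i, V (u i) (u (τ i))) - Finset.univ.sup fun i => V (u i) (u (τ i))})
    ⟨fun i => (f i : Fin m), τ, fun a b hab => f.strictMono hab, rfl⟩
  have h2 := Finset.le_sup (f := fun i => V (f i) (f (τ i))) (Finset.mem_univ j)
  have h3 : (Finset.univ.sup fun i => V (f i) (f (τ i))) ≤ ∑ i, V (f i) (f (τ i)) :=
    Finset.sup_le fun i hi =>
      Finset.single_le_sum (f := fun i => V (f i) (f (τ i))) (fun _ _ => Nat.zero_le _) hi
  simp only at h1 h2 h3 ⊢
  omega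
end

section
/- Let n ≥ 1 and N ≥ 2(n+1) be integers, and fix nonnegative integers a_0,…,a_n and b_0,…,b_{n−1} with c_0 = a_0, c_i = a_i + b_{i−1} for 1 ≤ i ≤ n, and m = c_0 + ⋯ + c_n. Partition {1,…,m} as I_X ⊔ I_D with I_X partitioned into blocks X_n,…,X_0 of sizes a_i and I_D into blocks D_{n−1},…,D_0 of sizes b_j, and define the m×m integer array V by: V(r,s) = i if r ∈ I_X and s ∈ X_i; V(r,s) = 0 if r ∈ I_X and s ∈ I_D; V(r,s) = N if r ∈ I_D and s ∈ I_X; and V(r,s) = j+1 if r ∈ I_D and s ∈ D_j. Let Γ(l) be the sum of the l smallest elements of the multiset in which each i ∈ {0,…,n} occurs with multiplicity c_i. Then for every 1 ≤ l ≤ m, every choice of indices 1 ≤ u_1 < … < u_l ≤ m, and every permutation τ of {1,…,l}, one has Σ_{i=1}^l V(u_i, u_{τ(i)}) − max_{1 ≤ i ≤ l} V(u_i, u_{τ(i)}) ≥ Γ(max(l−2, 0)). -/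
open scoped BigOperators

theorem cc_take_le : ∀ (L : List ℕ), L.Pairwise (· ≤ ·) → ∀ (t : List ℕ) (p : ℕ),
    t.Sublist L → p ≤ t.length → (L.take p).sum ≤ t.sum := by
  intro L
  induction L with
  | nil => intro _ t p _ _; simp
  | cons x L ih =>
    intro hL t p ht hp
    rw [List.pairwise_cons] at hL
    cases p with
    | zero => simp
    | succ q =>
      cases t with
      | nil => simp at hp
      | cons y t =>
        simp only [List.length_cons, Nat.add_le_add_iff_right] at hp
        simp only [List.take_succ_cons, List.sum_cons]
        cases ht with
        | cons _ h =>
          have h1 := hL.1 y (h.subset (by simp))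
          have h2 := ih hL.2 t q ((List.sublist_cons_self y t).trans h) hp
          omega
        | cons_cons _ h =>
          have h2 := ih hL.2 t q h hp
          omega

theorem cc_gamma_le {n : ℕ} (c : Fin (n + 1) → ℕ) {ι : Type*} [Fintype ι] [DecidableEq ι]
    (W : ι → Fin (n + 1))
    (hW : ∀ k, (Finset.univ.filter fun r => W r = k).card = c k)
    (S : Finset ι) (p : ℕ) (hp : p ≤ S.card) :
    hodgeGamma c p ≤ ∑ r ∈ S, (W r : ℕ) := by
  have hmul : (∑ i : Fin (n + 1), Multiset.replicate (c i) (i : ℕ))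
      = (Finset.univ : Finset ι).val.map (fun r => (W r : ℕ)) := by
    have : ∀ i : Fin (n+1), Multiset.replicate (c i) (i : ℕ)
        = (Multiset.replicate (c i) i).map (fun k : Fin (n+1) => (k : ℕ)) := by
      intro i; simp
    simp_rw [this]
    have h2 : (Finset.univ : Finset ι).val.map (fun r => (W r : ℕ))
        = ((Finset.univ : Finset ι).val.map W).map (fun k : Fin (n+1) => (k : ℕ)) := by
      rw [Multiset.map_map]; rfl
    rw [h2, ← Multiset.coe_mapAddMonoidHom, ← map_sum]
    congr 1
    ext k
    rw [Multiset.count_sum', Multiset.count_map]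
    have h3 : (Multiset.filter (fun a => k = W a) (Finset.univ : Finset ι).val).card = c k := by
      rw [← hW k]
      simp_rw [eq_comm (a := k)]
      rfl
    rw [h3]
    simp [Multiset.count_replicate]
  unfold hodgeGamma
  rw [hmul]
  have hle : S.val.map (fun r => (W r : ℕ)) ≤
      (Finset.univ : Finset ι).val.map (fun r => (W r : ℕ)) :=
    Multiset.map_le_map (Finset.val_le_iff.2 (Finset.subset_univ S))
  set A := S.val.map (fun r => (W r : ℕ)) with hA
  set B := (Finset.univ : Finset ι).val.map (fun r => (W r : ℕ)) with hB
  have hs : (∑ r ∈ S, (W r : ℕ)) = (A.sort (· ≤ ·)).sum := by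
    rw [← Multiset.sum_coe, Multiset.sort_eq]; rfl
  rw [hs]
  apply cc_take_le
  · exact Multiset.pairwise_sort _ _
  · apply List.sublist_of_subperm_of_pairwise (r := (· ≤ ·))
    · rw [← Multiset.coe_le, Multiset.sort_eq, Multiset.sort_eq]; exact hle
    · exact Multiset.pairwise_sort _ _
    · exact Multiset.pairwise_sort _ _
  · simpa [hA] using hp

/-- Combinatorial core of the precision-loss lemma: for the array `V`
of valuation lower bounds attached to the Hodge data of the pair `(X̄, D)` and `N ≥
2(n+1)`, every selection of `l` positions from distinct rows and distinct columns has
`Σ_i V(u_i, u_{τ(i)}) - max_i V(u_i, u_{τ(i)}) ≥ Γ(max(l-2, 0))`. -/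
theorem combinatorial_core (n : ℕ) (hn : 1 ≤ n) (N : ℕ) (hN : 2 * (n + 1) ≤ N)
    (a : Fin (n + 1) → ℕ) (b : Fin n → ℕ) (c : Fin (n + 1) → ℕ)
    (hc0 : c 0 = a 0) (hc : ∀ i : Fin n, c i.succ = a i.succ + b i)
    (m : ℕ) (hm : m = ∑ i, c i)
    -- `lab` records the partition of the index set into the blocks `X_i` and `D_j`
    (lab : Fin m → Fin (n + 1) ⊕ Fin n)
    (hlabX : ∀ i : Fin (n + 1),
      (Finset.univ.filter fun r => lab r = Sum.inl i).card = a i)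
    (hlabD : ∀ j : Fin n,
      (Finset.univ.filter fun r => lab r = Sum.inr j).card = b j)
    (V : Fin m → Fin m → ℕ)
    (hV : ∀ r s, V r s = match lab r, lab s with
      | Sum.inl _, Sum.inl i => (i : ℕ)
      | Sum.inl _, Sum.inr _ => 0
      | Sum.inr _, Sum.inl _ => N
      | Sum.inr _, Sum.inr j => (j : ℕ) + 1) :
    ∀ l : ℕ, 1 ≤ l → l ≤ m → ∀ u : Fin l → Fin m, StrictMono u →
      ∀ τ : Equiv.Perm (Fin l),
        hodgeGamma c (l - 2) ≤
          (∑ i, V (u i) (u (τ i))) - Finset.univ.sup fun i => V (u i) (u (τ i)) := by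
  intro l hl _ u hu τ
  set W : Fin m → Fin (n + 1) := fun r => Sum.elim id Fin.succ (lab r) with hWdef
  set d : Fin m → ℤ := fun r => Sum.elim (fun _ => 0) (fun _ => 1) (lab r) with hd
  have hW : ∀ k, (Finset.univ.filter fun r => W r = k).card = c k := by
    intro k
    induction k using Fin.cases with
    | zero =>
      rw [hc0, ← hlabX 0]
      congr 1
      ext r
      simp only [Finset.mem_filter, Finset.mem_univ, true_and, hWdef]
      cases lab r <;> simp
    | succ j =>
      rw [hc, ← hlabX, ← hlabD, ← Finset.card_union_of_disjoint]
      · congr 1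
        ext r
        simp only [Finset.mem_filter, Finset.mem_univ, true_and, hWdef, Finset.mem_union]
        cases lab r <;> simp
      · rw [Finset.disjoint_left]
        intro r
        simp only [Finset.mem_filter, Finset.mem_univ, true_and]
        intro h; simp [h]
  -- columns
  have hinj : Function.Injective (fun i => u (τ i)) := hu.injective.comp τ.injective
  have hG : ∀ S : Finset (Fin l), l - 2 ≤ S.card →
      hodgeGamma c (l - 2) ≤ ∑ i ∈ S, (W (u (τ i)) : ℕ) := by
    intro S hS
    have := cc_gamma_le c W hW (S.map ⟨_, hinj⟩) (l - 2) (by simpa using hS)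
    simpa using this
  have hpt : ∀ r s, (W s : ℤ) + n * (d r - d s) ≤ V r s := by
    intro r s
    rw [hV]
    simp only [hWdef, hd]
    rcases lab r with i | j <;> rcases lab s with i' | j' <;> simp <;> omega
  have hsum0 : ∑ i, (d (u i) - d (u (τ i))) = 0 := by
    rw [Finset.sum_sub_distrib, Equiv.sum_comp τ (fun i => d (u i)), sub_self]
  have hnz : Nonempty (Fin l) := ⟨⟨0, hl⟩⟩
  obtain ⟨i0, -, hi0⟩ := Finset.exists_mem_eq_sup (Finset.univ : Finset (Fin l))
    Finset.univ_nonempty (fun i => V (u i) (u (τ i)))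
  have hmax : ∀ i, V (u i) (u (τ i)) ≤ V (u i0) (u (τ i0)) := by
    intro i
    rw [← hi0]
    exact Finset.le_sup (f := fun i => V (u i) (u (τ i))) (Finset.mem_univ i)
  rw [hi0, ← Finset.add_sum_erase _ _ (Finset.mem_univ i0), Nat.add_sub_cancel_left]
  have hbl : ∀ r s, d r - d s ≤ 1 ∧ (0 < d r - d s → V r s = N) ∧
      (d r - d s ≤ 0 → V r s ≤ n) ∧ (d r - d s = 0 → V r s = W s) := by
    intro r s
    rw [hV]
    simp only [hWdef, hd]
    rcases lab r with i | j <;> rcases lab s with i' | j' <;> simp <;> omega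
  by_cases h0 : 0 < d (u i0) - d (u (τ i0))
  · have hex : ∃ i1, d (u i1) - d (u (τ i1)) < 0 := by
      by_contra! hcon
      have := (Finset.sum_eq_zero_iff_of_nonneg (fun i _ => hcon i)).1 hsum0 i0 (Finset.mem_univ _)
      omega
    obtain ⟨i1, hi1⟩ := hex
    have hne : i1 ≠ i0 := by rintro rfl; omega
    have hmem : i1 ∈ Finset.univ.erase i0 := by simp [hne]
    have hd1 : d (u i1) - d (u (τ i1)) = -1 := by
      revert hi1
      simp only [hd]
      rcases lab (u i1) with i | j <;> rcases lab (u (τ i1)) with i' | j' <;> simp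
    have hd0 : d (u i0) - d (u (τ i0)) = 1 := by
      have := (hbl (u i0) (u (τ i0))).1; omega
    rw [← Finset.add_sum_erase _ _ (Finset.mem_univ i0), ← Finset.add_sum_erase _ _ hmem,
      hd1, hd0] at hsum0
    rw [← Finset.add_sum_erase _ _ hmem]
    set S := (Finset.univ.erase i0).erase i1 with hS
    have hcard : l - 2 ≤ S.card := by
      rw [hS, Finset.card_erase_of_mem hmem, Finset.card_erase_of_mem (Finset.mem_univ _)]
      simp; omega
    refine (hG S hcard).trans ?_
    have hle : ∑ i ∈ S, ((W (u (τ i)) : ℤ) + n * (d (u i) - d (u (τ i))))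
        ≤ ∑ i ∈ S, (V (u i) (u (τ i)) : ℤ) := Finset.sum_le_sum (fun i _ => hpt _ _)
    have hz : ∑ i ∈ S, (d (u i) - d (u (τ i))) = 0 := by linarith
    rw [Finset.sum_add_distrib, ← Finset.mul_sum, hz, mul_zero, add_zero] at hle
    have hle' : ∑ i ∈ S, (W (u (τ i)) : ℕ) ≤ ∑ i ∈ S, V (u i) (u (τ i)) := by
      exact_mod_cast hle
    omega
  · have hV0 := (hbl (u i0) (u (τ i0))).2.2.1 (by omega)
    have hnon : ∀ i, d (u i) - d (u (τ i)) ≤ 0 := by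
      intro i
      by_contra! hcon
      have h1 := (hbl (u i) (u (τ i))).2.1 hcon
      have h2 := hmax i
      omega
    have hall := (Finset.sum_eq_zero_iff_of_nonpos (fun i _ => hnon i)).1 hsum0
    have hcard : l - 2 ≤ (Finset.univ.erase i0).card := by
      rw [Finset.card_erase_of_mem (Finset.mem_univ _)]
      simp; omega
    refine (hG _ hcard).trans (le_of_eq ?_)
    exact Finset.sum_congr rfl
      (fun i _ => ((hbl (u i) (u (τ i))).2.2.2 (hall i (Finset.mem_univ _))).symm)
end
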